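/- arXiv:0902.0844 — 2 statements merged into one kernel-verified Lean document; each statement's English description precedes it below -/
import Mathlib

section
/- Let K be a difference subfield of U with σ(K) = K, and let a, b be finite tuples from U such that σ(a) and b lie in K(a)^alg and σ(b) ∈ K(b)^alg. Then there is a constant D ∈ ℕ (one may take D = μ(b/K(a))) such that for every k ∈ ℕ, μ((σ^k(a),σ^k(b))/K(a,b)) ≤ D·μ(σ^k(a)/K(a)). Consequently dd(b/K) ≤ dd(a/K). -/
/- Setting: a large algebraically closed field `U` with an automorphism `σ`.
   Tuples are maps `Fin n → U`; for a tuple `t`, the relevant set of coordinates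
   is `Set.range t`.  `fAdj E s` is the subfield `E(s)` generated by a subfield
   `E` and a set `s`, and `deg E s` is the degree `μ(s/E) = [E(s):E]`. -/

set_option maxHeartbeats 1000000
set_option synthInstance.maxHeartbeats 1000000

open Filter Set

variable {U : Type*}

/-- The subfield `E(s)` generated by the subfield `E` and the set `s`. -/
noncomputable def fAdj [Field U] (E : Subfield U) (s : Set U) : Subfield U :=
  (IntermediateField.adjoin E s).toSubfield

/-- The degree `μ(s/E) = [E(s):E]` (as `Module.finrank`; it is `0` when infinite). -/
noncomputable def deg [Field U] (E : Subfield U) (s : Set U) : ℕ :=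
  Module.finrank E (IntermediateField.adjoin E s)

/-- `k ↦ μ(σ^{k+1}(s) / K(s, σ(s), …, σ^k(s)))`: the sequence whose eventual
value is the limit degree `ld(s/K)`. -/
noncomputable def ldSeq [Field U] (σ : U ≃+* U) (K : Subfield U) (s : Set U) (k : ℕ) : ℕ :=
  deg (fAdj K (⋃ i ∈ Set.Iic k, ⇑(σ ^ i) '' s)) (⇑(σ ^ (k + 1)) '' s)

/-- `k ↦ μ(σ^k(s) / K(s))`: the sequence whose `k`-th roots converge to the
distant degree `dd(s/K)`. -/
noncomputable def ddSeq [Field U] (σ : U ≃+* U) (K : Subfield U) (s : Set U) (k : ℕ) : ℕ :=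
  deg (fAdj K s) (⇑(σ ^ k) '' s)

/-- The inversive closure `K^inv = ⋃ₙ σ^{-n}(K)`. -/
noncomputable def Kinv [Field U] (σ : U ≃+* U) (K : Subfield U) : Subfield U :=
  ⨆ n : ℕ, K.map (σ⁻¹ ^ n : U ≃+* U).toRingHom

/-- The difference field `K(s)_σ = K(σ^i(s) : i ∈ ℕ)` generated by `s` over `K`. -/
noncomputable def diffAdj [Field U] (σ : U ≃+* U) (K : Subfield U) (s : Set U) : Subfield U :=
  fAdj K (⋃ i : ℕ, ⇑(σ ^ i) '' s)


section Adjunction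

variable [Field U] {E F : Subfield U} {s t : Set U}

theorem fAdj_le_iff : fAdj E s ≤ F ↔ E ≤ F ∧ s ⊆ F := by
  change Subfield.closure (Set.range (algebraMap E U) ∪ s) ≤ F ↔ _
  rw [Subfield.closure_le, Set.union_subset_iff]
  refine and_congr_left fun _ => ⟨fun h x hx => h ⟨⟨x, hx⟩, rfl⟩, ?_⟩
  rintro h _ ⟨x, rfl⟩
  exact h x.2

theorem le_fAdj : E ≤ fAdj E s := (fAdj_le_iff.1 le_rfl).1

theorem subset_fAdj : s ⊆ fAdj E s := (fAdj_le_iff.1 le_rfl).2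

theorem fAdj_mono (hE : E ≤ F) (hs : s ⊆ t) : fAdj E s ≤ fAdj F t :=
  fAdj_le_iff.2 ⟨hE.trans le_fAdj, hs.trans subset_fAdj⟩

theorem fAdj_fAdj : fAdj (fAdj E s) t = fAdj E (s ∪ t) := by
  apply le_antisymm
  · exact fAdj_le_iff.2 ⟨fAdj_mono le_rfl subset_union_left, subset_union_right.trans subset_fAdj⟩
  · exact fAdj_le_iff.2 ⟨le_fAdj.trans le_fAdj, union_subset (subset_fAdj.trans le_fAdj) subset_fAdj⟩

theorem map_fAdj (τ : U ≃+* U) :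
    (fAdj E s).map τ.toRingHom = fAdj (E.map τ.toRingHom) (τ '' s) := by
  apply le_antisymm
  · rw [Subfield.map_le_iff_le_comap, fAdj_le_iff]
    exact ⟨fun x hx => le_fAdj ⟨x, hx, rfl⟩, fun x hx => subset_fAdj ⟨x, hx, rfl⟩⟩
  · rw [fAdj_le_iff]
    refine ⟨(Subfield.gc_map_comap _).monotone_l le_fAdj, ?_⟩
    rintro _ ⟨x, hx, rfl⟩
    exact ⟨x, subset_fAdj hx, rfl⟩

theorem deg_eq_relfinrank : deg E s = Subfield.relfinrank E (fAdj E s) := by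
  rw [Subfield.relfinrank_eq_finrank_of_le le_fAdj]
  rfl

theorem deg_union : deg E (s ∪ t) = deg E s * deg (fAdj E s) t := by
  rw [deg_eq_relfinrank, deg_eq_relfinrank, deg_eq_relfinrank, fAdj_fAdj]
  exact (Subfield.relfinrank_mul_relfinrank le_fAdj (fAdj_mono le_rfl subset_union_left)).symm

theorem deg_map (τ : U ≃+* U) : deg (E.map τ.toRingHom) (τ '' s) = deg E s := by
  rw [deg_eq_relfinrank, deg_eq_relfinrank, ← map_fAdj, Subfield.relfinrank_map_map]

theorem deg_pos (hs : s.Finite) (h : ∀ x ∈ s, IsAlgebraic E x) : 0 < deg E s := by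
  have := hs.to_subtype
  have := IntermediateField.finiteDimensional_adjoin fun x hx => (h x hx).isIntegral
  exact Module.finrank_pos

theorem isAlgebraic_mono (h : E ≤ F) {x : U} (hx : IsAlgebraic E x) : IsAlgebraic F x := by
  let _ : Algebra E F := (Subfield.inclusion h).toAlgebra
  have : IsScalarTower E F U := .of_algebraMap_eq fun _ => rfl
  exact hx.tower_top F

theorem isAlgebraic_of_fAdj (hs : ∀ x ∈ s, IsAlgebraic E x) {y : U}
    (hy : IsAlgebraic (fAdj E s) y) : IsAlgebraic E y := by
  have := IntermediateField.isAlgebraic_adjoin fun x hx => (hs x hx).isIntegral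
  have hy' : IsAlgebraic (IntermediateField.adjoin E s) y := hy
  exact hy'.restrictScalars E

theorem isAlgebraic_map (τ : U ≃+* U) {x : U} (hx : IsAlgebraic E x) :
    IsAlgebraic (E.map τ.toRingHom) (τ x) := by
  obtain ⟨p, hp, hpx⟩ := hx
  let f : E →+* E.map τ.toRingHom :=
    (τ.toRingHom.comp E.subtype).codRestrict _ fun y => ⟨y, y.2, rfl⟩
  refine ⟨p.map f, (Polynomial.map_ne_zero_iff f.injective).2 hp, ?_⟩
  rw [Polynomial.aeval_def, Polynomial.eval₂_map]
  have : (algebraMap (E.map τ.toRingHom) U).comp f = τ.toRingHom.comp (algebraMap E U) := rfl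
  rw [this]
  have := congrArg τ.toRingHom hpx
  rwa [Polynomial.aeval_def, Polynomial.hom_eval₂, map_zero] at this

theorem deg_le_of_le (h : E ≤ F) (hs : s.Finite) (halg : ∀ x ∈ s, IsAlgebraic E x) :
    deg F s ≤ deg E s := by
  let _ : Algebra E F := (Subfield.inclusion h).toAlgebra
  have : IsScalarTower E F U := .of_algebraMap_eq fun _ => rfl
  have := hs.to_subtype
  have hfin := IntermediateField.finiteDimensional_adjoin fun x hx => (halg x hx).isIntegral
  have key := IntermediateField.adjoin_rank_le_of_isAlgebraic_right F (IntermediateField.adjoin E s)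
  have heq : IntermediateField.adjoin F (IntermediateField.adjoin E s : Set U) =
      IntermediateField.adjoin F s := by
    apply le_antisymm
    · rw [IntermediateField.adjoin_le_iff]
      exact fAdj_mono h le_rfl
    · exact IntermediateField.adjoin.mono _ _ _ (IntermediateField.subset_adjoin E s)
  rw [heq] at key
  exact Cardinal.toNat_le_toNat key (Module.rank_lt_aleph0 _ _)

theorem deg_le_deg_union (hs : s.Finite) (halg : ∀ x ∈ s, IsAlgebraic E x) :
    deg E t ≤ deg E (s ∪ t) := by
  rw [union_comm, deg_union]
  exact Nat.le_mul_of_pos_right _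
    (deg_pos hs fun x hx => isAlgebraic_mono le_fAdj (halg x hx))

end Adjunction

section PurelyTranscendental

open IntermediateField.algebraAdjoinAdjoin

/-- A finite extension is linearly disjoint from a purely transcendental one. -/
theorem AlgebraicIndependent.linearDisjoint_adjoin {F L ι : Type*} [Field F] [Field L]
    [Algebra F L] {x : ι → L} (hx : AlgebraicIndependent F x) (A : IntermediateField F L)
    [Algebra.IsAlgebraic F A] : A.LinearDisjoint (IntermediateField.adjoin F (Set.range x)) := by
  have hA : AlgebraicIndependent A x := hx.extendScalars A
  have hdisj : A.toSubalgebra.LinearDisjoint (Algebra.adjoin F (Set.range x)) := by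
    refine Subalgebra.LinearDisjoint.of_basis_right _ _
      ((MvPolynomial.basisMonomials ι F).map hx.aevalEquiv.toLinearEquiv) ?_
    have := (MvPolynomial.basisMonomials ι A).linearIndependent.map'
      (MvPolynomial.aeval (R := A) x).toLinearMap (LinearMap.ker_eq_bot.2 hA)
    convert! this using 1
    ext m
    simp [MvPolynomial.aeval_monomial]
  have hb := hdisj.linearIndependent_left_of_flat (Module.Basis.ofVectorSpace F A).linearIndependent
  exact .of_basis_left (Module.Basis.ofVectorSpace F A)
    ((LinearIndependent.iff_fractionRing (Algebra.adjoin F (Set.range x)) _).1 hb)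

variable [Field U] {E : Subfield U} {s t : Set U}

theorem deg_fAdj_of_algebraicIndepOn (ht : AlgebraicIndepOn E id t)
    (halg : ∀ x ∈ s, IsAlgebraic E x) : deg (fAdj E t) s = deg E s := by
  have := IntermediateField.isAlgebraic_adjoin fun x hx => (halg x hx).isIntegral
  have key := (AlgebraicIndependent.linearDisjoint_adjoin ht
    (IntermediateField.adjoin E s)).adjoin_rank_eq_rank_left_of_isAlgebraic_left
  have hr : Set.range (fun i : t => id (i : U)) = t := Subtype.range_coe
  rw [hr] at key
  have heq : IntermediateField.adjoin (IntermediateField.adjoin E t)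
      (IntermediateField.adjoin E s : Set U) =
      IntermediateField.adjoin (IntermediateField.adjoin E t) s := by
    apply le_antisymm
    · rw [IntermediateField.adjoin_le_iff]
      exact fAdj_mono le_fAdj le_rfl
    · exact IntermediateField.adjoin.mono _ _ _ (IntermediateField.subset_adjoin E s)
  rw [heq] at key
  exact congrArg Cardinal.toNat key

theorem exists_algebraicIndepOn_subset (s : Set U) :
    ∃ t ⊆ s, AlgebraicIndepOn E id t ∧ ∀ x ∈ s, IsAlgebraic (fAdj E t) x := by
  obtain ⟨t, -, ⟨ht, hts⟩, hmax⟩ := exists_maximal_algebraicIndependent (R := E) ∅ s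
    (empty_subset s) ((algebraicIndependent_empty_iff E U).2 (algebraMap E U).injective)
  refine ⟨t, hts, ht, fun x hx => ?_⟩
  by_cases hxt : x ∈ t
  · exact isAlgebraic_algebraMap (⟨x, subset_fAdj hxt⟩ : fAdj E t)
  by_contra h
  refine hxt (hmax ⟨ht.insert fun halg => h ?_, insert_subset hx hts⟩
    (subset_insert x t) (mem_insert x t))
  rw [image_id] at halg
  exact halg.extendScalars (S := IntermediateField.adjoin E t) (Subalgebra.inclusion_injective
    (IntermediateField.algebra_adjoin_le_adjoin E t))

/-- Over a finitely generated extension, degrees drop at most by a bounded factor. -/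
theorem exists_deg_le_mul (hs : s.Finite) : ∃ C : ℕ, 0 < C ∧ ∀ t : Set U,
    (∀ x ∈ t, IsAlgebraic E x) → deg E t ≤ C * deg (fAdj E s) t := by
  obtain ⟨u, hus, hu, halg⟩ := exists_algebraicIndepOn_subset (E := E) s
  refine ⟨deg (fAdj E u) s, deg_pos hs halg, fun t htalg => ?_⟩
  have h : fAdj (fAdj E u) s = fAdj E s := by rw [fAdj_fAdj, union_eq_self_of_subset_left hus]
  rw [← deg_fAdj_of_algebraicIndepOn hu htalg, ← h, ← deg_union]
  exact deg_le_deg_union hs halg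

end PurelyTranscendental

section DistantDegree

variable [Field U] {σ : U ≃+* U} {K : Subfield U} {s t : Set U}

theorem map_pow_eq_self (hK : K.map σ.toRingHom = K) (k : ℕ) :
    K.map (σ ^ k).toRingHom = K := by
  induction k with
  | zero => exact SetLike.coe_injective (image_id _)
  | succ k ih =>
    calc K.map (σ ^ (k + 1)).toRingHom = (K.map σ.toRingHom).map (σ ^ k).toRingHom := by
          rw [Subfield.map_map]; rfl
      _ = K := by rw [hK, ih]

theorem isAlgebraic_pow_apply (hK : K.map σ.toRingHom = K)
    (hs : ∀ x ∈ s, IsAlgebraic (fAdj K s) (σ x)) (k : ℕ) :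
    ∀ x ∈ s, IsAlgebraic (fAdj K s) ((σ ^ k) x) := by
  induction k with
  | zero => exact fun x hx => isAlgebraic_algebraMap (⟨x, subset_fAdj hx⟩ : fAdj K s)
  | succ k ih =>
    intro x hx
    have h := isAlgebraic_map σ (ih x hx)
    rw [map_fAdj, hK] at h
    rw [pow_succ']
    exact isAlgebraic_of_fAdj (s := σ '' s) (forall_mem_image.2 hs)
      (isAlgebraic_mono (fAdj_mono le_fAdj le_rfl) h)

theorem deg_image_pow_union_le (hK : K.map σ.toRingHom = K) (hsf : s.Finite) (htf : t.Finite)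
    (hs : ∀ x ∈ s, IsAlgebraic (fAdj K s) (σ x)) (ht : ∀ x ∈ t, IsAlgebraic (fAdj K s) x)
    (k : ℕ) :
    deg (fAdj K (s ∪ t)) (⇑(σ ^ k) '' (s ∪ t)) ≤ deg (fAdj K s) t * ddSeq σ K s k := by
  have hmap : (fAdj K s).map (σ ^ k).toRingHom = fAdj K (⇑(σ ^ k) '' s) := by
    rw [map_fAdj, map_pow_eq_self hK]
  rw [image_union, deg_union, mul_comm, ← deg_map (σ ^ k) (E := fAdj K s), hmap]
  refine Nat.mul_le_mul ?_ ?_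
  · refine deg_le_of_le (fAdj_mono le_fAdj le_rfl) (htf.image _) (forall_mem_image.2 ?_)
    intro x hx
    rw [← hmap]
    exact isAlgebraic_map _ (ht x hx)
  · exact deg_le_of_le (fAdj_mono le_rfl subset_union_left) (hsf.image _)
      (forall_mem_image.2 (isAlgebraic_pow_apply hK hs k))

theorem exists_ddSeq_le_mul (hK : K.map σ.toRingHom = K) (hsf : s.Finite) (htf : t.Finite)
    (hs : ∀ x ∈ s, IsAlgebraic (fAdj K s) (σ x)) (hst : ∀ x ∈ t, IsAlgebraic (fAdj K s) x)
    (ht : ∀ x ∈ t, IsAlgebraic (fAdj K t) (σ x)) :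
    ∃ C : ℕ, 0 < C ∧ ∀ k, ddSeq σ K t k ≤ C * ddSeq σ K s k := by
  obtain ⟨C, hC, h⟩ := exists_deg_le_mul (E := fAdj K t) hsf
  refine ⟨C * deg (fAdj K s) t, Nat.mul_pos hC (deg_pos htf hst), fun k => ?_⟩
  have hunion : fAdj (fAdj K t) s = fAdj K (s ∪ t) := by rw [fAdj_fAdj, union_comm]
  calc ddSeq σ K t k ≤ C * deg (fAdj K (s ∪ t)) (⇑(σ ^ k) '' t) :=
        hunion ▸ h _ (forall_mem_image.2 (isAlgebraic_pow_apply hK ht k))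
    _ ≤ C * deg (fAdj K (s ∪ t)) (⇑(σ ^ k) '' (s ∪ t)) := by
        rw [image_union]
        refine Nat.mul_le_mul le_rfl (deg_le_deg_union (hsf.image _) (forall_mem_image.2 ?_))
        exact fun x hx => isAlgebraic_mono (fAdj_mono le_rfl subset_union_left)
          (isAlgebraic_pow_apply hK hs k x hx)
    _ ≤ C * (deg (fAdj K s) t * ddSeq σ K s k) :=
        Nat.mul_le_mul le_rfl (deg_image_pow_union_le hK hsf htf hs hst k)
    _ = C * deg (fAdj K s) t * ddSeq σ K s k := (mul_assoc _ _ _).symm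

end DistantDegree

/-- A bounded factor does not affect the limit of `k`-th roots. -/
theorem le_of_tendsto_rpow_one_div {u v : ℕ → ℕ} {C : ℕ} (hC : 0 < C)
    (huv : ∀ k, u k ≤ C * v k) {x y : ℝ}
    (hu : Tendsto (fun k => (u k : ℝ) ^ (1 / (k : ℝ))) atTop (nhds x))
    (hv : Tendsto (fun k => (v k : ℝ) ^ (1 / (k : ℝ))) atTop (nhds y)) : x ≤ y := by
  have hC' : Tendsto (fun k : ℕ => (C : ℝ) ^ (1 / (k : ℝ))) atTop (nhds 1) := by
    have h := tendsto_one_div_atTop_nhds_zero_nat (𝕜 := ℝ)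
    have hC0 : (C : ℝ) ≠ 0 := by exact_mod_cast hC.ne'
    simpa using tendsto_const_nhds.rpow h (.inl hC0)
  have hlim := hC'.mul hv
  rw [one_mul] at hlim
  refine le_of_tendsto_of_tendsto' hu hlim fun k => ?_
  rw [← Real.mul_rpow (by positivity) (by positivity)]
  exact Real.rpow_le_rpow (by positivity) (by exact_mod_cast huv k) (by positivity)

/-- if `σ(a), b ∈ K(a)^alg` and `σ(b) ∈ K(b)^alg`, then there is a
constant `D` (one may take `D = μ(b/K(a))`) with
`μ((σ^k(a),σ^k(b))/K(a,b)) ≤ D·μ(σ^k(a)/K(a))` for all `k`; consequently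
`dd(b/K) ≤ dd(a/K)`. -/
theorem stmt0 [Field U] [IsAlgClosed U] (σ : U ≃+* U) (K : Subfield U)
    (hK : K.map σ.toRingHom = K) {n m : ℕ} (a : Fin n → U) (b : Fin m → U)
    (ha : ∀ i, IsAlgebraic (fAdj K (Set.range a)) (σ (a i)))
    (hba : ∀ j, IsAlgebraic (fAdj K (Set.range a)) (b j))
    (hb : ∀ j, IsAlgebraic (fAdj K (Set.range b)) (σ (b j))) :
    (∃ D : ℕ, D = deg (fAdj K (Set.range a)) (Set.range b) ∧
      ∀ k : ℕ, deg (fAdj K (Set.range a ∪ Set.range b))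
          (⇑(σ ^ k) '' (Set.range a ∪ Set.range b)) ≤ D * ddSeq σ K (Set.range a) k) ∧
    ∀ Da Db : ℝ,
      Tendsto (fun k => (ddSeq σ K (Set.range a) k : ℝ) ^ (1 / (k : ℝ))) atTop (nhds Da) →
      Tendsto (fun k => (ddSeq σ K (Set.range b) k : ℝ) ^ (1 / (k : ℝ))) atTop (nhds Db) →
      Db ≤ Da := by
  refine ⟨⟨_, rfl, deg_image_pow_union_le hK (finite_range a) (finite_range b)
    (forall_mem_range.2 ha) (forall_mem_range.2 hba)⟩, fun Da Db hDa hDb => ?_⟩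
  obtain ⟨C, hC, h⟩ := exists_ddSeq_le_mul hK (finite_range a) (finite_range b)
    (forall_mem_range.2 ha) (forall_mem_range.2 hba) (forall_mem_range.2 hb)
  exact le_of_tendsto_rpow_one_div hC h hDb hDa
end

section
/- Let K be a difference subfield of U with σ(K) = K, and let a be a finite tuple from U such that σ(a) ∈ K(a)^alg. Then there is a finite tuple c whose coordinates lie in K(a)_σ such that a ∈ K(c)^alg (every coordinate of a is algebraic over K(c)) and, for every ℓ > 0, σ(c) ∈ K(c,σ^ℓ(c)) (every coordinate of σ(c) lies in the field K(c,σ^ℓ(c))). -/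
/- Setting: a large algebraically closed field `U` with an automorphism `σ`.
   Tuples are maps `Fin n → U`; for a tuple `t`, the relevant set of coordinates
   is `Set.range t`.  `fAdj E s` is the subfield `E(s)` generated by a subfield
   `E` and a set `s`, and `deg E s` is the degree `μ(s/E) = [E(s):E]`. -/

set_option maxHeartbeats 1000000
set_option synthInstance.maxHeartbeats 1000000

open Filter Set

variable {U : Type*}

namespace Subfield

variable [Field U] {A B C D : Subfield U}

/-- A finite extension `B / A` stays finite, of no larger degree, after compositum with `C`. -/
theorem relfinrank_sup_right_le (hAB : A ≤ B) (h : 0 < A.relfinrank B) (C : Subfield U) :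
    0 < (A ⊔ C).relfinrank (B ⊔ C) ∧ (A ⊔ C).relfinrank (B ⊔ C) ≤ A.relfinrank B := by
  let L : IntermediateField A U := extendScalars hAB
  let M : IntermediateField A U := extendScalars (le_sup_left : A ≤ A ⊔ C)
  have hfin : Module.finrank A L = A.relfinrank B := (relfinrank_eq_finrank_of_le hAB).symm
  have : FiniteDimensional A L := FiniteDimensional.of_finrank_pos (hfin ▸ h)
  have hle : Module.rank M (IntermediateField.adjoin M (L : Set U)) ≤ Module.rank A L :=
    IntermediateField.adjoin_rank_le_of_isAlgebraic_right M L
  have heq : (IntermediateField.adjoin M (L : Set U)).toSubfield = B ⊔ C := by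
    apply le_antisymm
    · have h₁ : A ⊔ C ≤ B ⊔ C := sup_le_sup_right hAB C
      exact IntermediateField.adjoin_le_iff (T := extendScalars h₁).2
        (fun x hx => (le_sup_left : B ≤ B ⊔ C) hx)
    · refine sup_le (fun x hx => IntermediateField.subset_adjoin M (L : Set U) hx) fun x hx => ?_
      exact (IntermediateField.adjoin M (L : Set U)).algebraMap_mem
        ⟨x, (le_sup_right : C ≤ A ⊔ C) hx⟩
  have hrank : Module.rank M (IntermediateField.adjoin M (L : Set U)) =
      (A ⊔ C).relrank (B ⊔ C) := by
    have h₁ : A ⊔ C ≤ (IntermediateField.adjoin M (L : Set U)).toSubfield :=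
      heq ▸ sup_le_sup_right hAB C
    rw [← heq, relrank_eq_rank_of_le h₁]
    rfl
  have hlt : Module.rank A L < Cardinal.aleph0 := Module.rank_lt_aleph0 A L
  rw [hrank] at hle
  constructor
  · have hAC : A ⊔ C ≤ B ⊔ C := sup_le_sup_right hAB C
    rw [relfinrank_eq_toNat_relrank]
    refine Cardinal.toNat_pos.2 ⟨?_, hle.trans_lt hlt⟩
    rw [relrank_eq_rank_of_le hAC]
    exact rank_pos.ne'
  · rw [relfinrank_eq_toNat_relrank, ← hfin]
    exact Cardinal.toNat_le_toNat hle hlt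

theorem relfinrank_pos_trans (hAB : A ≤ B) (hBC : B ≤ C) (h₁ : 0 < A.relfinrank B)
    (h₂ : 0 < B.relfinrank C) : 0 < A.relfinrank C := by
  rw [← relfinrank_mul_relfinrank hAB hBC]
  exact Nat.mul_pos h₁ h₂

theorem relfinrank_pos_left (hAB : A ≤ B) (hBC : B ≤ C) (h : 0 < A.relfinrank C) :
    0 < A.relfinrank B := by
  rw [← relfinrank_mul_relfinrank hAB hBC] at h
  exact Nat.pos_of_mul_pos_right h

theorem relfinrank_pos_right (hAB : A ≤ B) (hBC : B ≤ C) (h : 0 < A.relfinrank C) :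
    0 < B.relfinrank C := by
  rw [← relfinrank_mul_relfinrank hAB hBC] at h
  exact Nat.pos_of_mul_pos_left h

theorem relfinrank_mono_right (hAB : A ≤ B) (hBC : B ≤ C) (h : 0 < A.relfinrank C) :
    A.relfinrank B ≤ A.relfinrank C := by
  rw [← relfinrank_mul_relfinrank hAB hBC]
  exact Nat.le_mul_of_pos_right _ (relfinrank_pos_right hAB hBC h)

theorem relfinrank_anti_left (hAB : A ≤ B) (hBC : B ≤ C) (h : 0 < A.relfinrank C) :
    B.relfinrank C ≤ A.relfinrank C := by
  rw [← relfinrank_mul_relfinrank hAB hBC]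
  exact Nat.le_mul_of_pos_left _ (relfinrank_pos_left hAB hBC h)

/-- If the degree of `B / A` does not drop after compositum with `C`, neither does that of a
lower subextension. -/
theorem relfinrank_sup_eq_of_le (hAB : A ≤ B) (hBC : B ≤ C) (h : 0 < A.relfinrank C)
    (hD : A.relfinrank C ≤ (A ⊔ D).relfinrank (C ⊔ D)) :
    (A ⊔ D).relfinrank (B ⊔ D) = A.relfinrank B := by
  have h₁ := relfinrank_pos_left hAB hBC h
  have h₂ := relfinrank_pos_right hAB hBC h
  have e₁ := relfinrank_sup_right_le hAB h₁ D
  have e₂ := relfinrank_sup_right_le hBC h₂ D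
  rw [← relfinrank_mul_relfinrank hAB hBC, ← relfinrank_mul_relfinrank
    (sup_le_sup_right hAB D) (sup_le_sup_right hBC D)] at hD
  refine le_antisymm e₁.2 (Nat.le_of_mul_le_mul_right (hD.trans ?_) h₂)
  exact Nat.mul_le_mul_left _ e₂.2

/-- If the degree of `B / A` does not drop after compositum with `D`, then `B` meets `A ⊔ D`
only in `A`. -/
theorem inf_sup_le_of_relfinrank_le (hAB : A ≤ B) (h : 0 < A.relfinrank B)
    (hD : A.relfinrank B ≤ (A ⊔ D).relfinrank (B ⊔ D)) : B ⊓ (A ⊔ D) ≤ A := by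
  have h₁ : A ≤ B ⊓ (A ⊔ D) := le_inf hAB le_sup_left
  have := relfinrank_sup_eq_of_le h₁ inf_le_left h hD
  refine relfinrank_eq_one_iff.1 (this.symm.trans (relfinrank_eq_one_iff.2 ?_))
  exact sup_le inf_le_right le_sup_right

/-- The part of the degree equality of `relfinrank_sup_eq_of_le` for an upper subextension. -/
theorem relfinrank_le_sup_of_le (hAB : A ≤ B) (hBC : B ≤ C) (h : 0 < A.relfinrank C)
    (hD : A.relfinrank C ≤ (A ⊔ D).relfinrank (C ⊔ D)) :
    B.relfinrank C ≤ (B ⊔ D).relfinrank (C ⊔ D) := by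
  have h₁ := relfinrank_pos_left hAB hBC h
  have e := relfinrank_sup_eq_of_le hAB hBC h hD
  rw [← relfinrank_mul_relfinrank hAB hBC, ← relfinrank_mul_relfinrank
    (sup_le_sup_right hAB D) (sup_le_sup_right hBC D), e] at hD
  exact Nat.le_of_mul_le_mul_left hD h₁

/-- The relative algebraic closure of a subfield, as a subfield. -/
noncomputable def algClosure (A : Subfield U) : Subfield U := (algebraicClosure A U).toSubfield

theorem mem_algClosure {x : U} : x ∈ A.algClosure ↔ IsAlgebraic A x :=
  mem_algebraicClosure_iff

theorem le_algClosure (A : Subfield U) : A ≤ A.algClosure := fun x hx =>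
  mem_algClosure.2 (isAlgebraic_algebraMap (⟨x, hx⟩ : A))

theorem algClosure_mono (h : A ≤ B) : A.algClosure ≤ B.algClosure := fun x hx => by
  rw [mem_algClosure] at hx ⊢
  obtain ⟨p, hp, hx⟩ := hx
  refine ⟨p.map (inclusion h), (Polynomial.map_ne_zero_iff (inclusion h).injective).2 hp, ?_⟩
  rw [Polynomial.aeval_def, Polynomial.eval₂_map]
  exact hx

theorem algClosure_le_of_le (h : B ≤ A.algClosure) : B.algClosure ≤ A.algClosure := by
  refine (algClosure_mono h).trans fun x hx => ?_
  have hx' : IsAlgebraic (algebraicClosure A U) x := mem_algClosure.1 hx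
  exact mem_algClosure.2 (hx'.restrictScalars A)

theorem map_algClosure (A : Subfield U) (σ : U ≃+* U) :
    A.algClosure.map σ.toRingHom ≤ (A.map σ.toRingHom).algClosure := by
  rintro _ ⟨x, hx, rfl⟩
  obtain ⟨p, hp, hx⟩ := mem_algClosure.1 hx
  let f : A →+* A.map σ.toRingHom :=
    (σ.toRingHom.comp A.subtype).codRestrict _ fun y => ⟨y, y.2, rfl⟩
  refine mem_algClosure.2 ⟨p.map f, (Polynomial.map_ne_zero_iff f.injective).2 hp, ?_⟩
  rw [Polynomial.aeval_def, Polynomial.eval₂_map]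
  have := congrArg σ hx
  rw [Polynomial.aeval_def, map_zero] at this
  rw [← this]
  exact (Polynomial.hom_eval₂ p (algebraMap A U) σ.toRingHom x).symm

theorem toSubfield_adjoin (K : Subfield U) (s : Set U) :
    (IntermediateField.adjoin K s).toSubfield = K ⊔ closure s := by
  rw [IntermediateField.adjoin_toSubfield, closure_union]
  congr 1
  refine closure_eq_of_le ?_ ?_
  · rintro _ ⟨y, rfl⟩
    exact y.2
  · exact fun x hx => subset_closure ⟨⟨x, hx⟩, rfl⟩

/-- Adjoining finitely many algebraic elements gives a finite extension. -/
theorem relfinrank_sup_closure_pos {t : Set U} (ht : t.Finite) (h : t ⊆ A.algClosure) :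
    0 < A.relfinrank (A ⊔ closure t) := by
  have : Finite t := ht
  have hfd : FiniteDimensional A (IntermediateField.adjoin A t) :=
    IntermediateField.finiteDimensional_adjoin fun x hx => (mem_algClosure.1 (h hx)).isIntegral
  have heq := toSubfield_adjoin A t
  rw [← heq, relfinrank_eq_finrank_of_le (heq ▸ le_sup_left)]
  exact Module.finrank_pos (R := A) (M := IntermediateField.adjoin A t)

end Subfield

namespace Subfield

variable [Field U] {A B : Subfield U}

theorem natDegree_minpoly_le_relfinrank (hAB : A ≤ B) (h : 0 < A.relfinrank B) {x : U}
    (hx : x ∈ B) : IsIntegral A x ∧ (minpoly A x).natDegree ≤ A.relfinrank B := by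
  let L : IntermediateField A U := extendScalars hAB
  have hfin : Module.finrank A L = A.relfinrank B := (relfinrank_eq_finrank_of_le hAB).symm
  have : FiniteDimensional A L := FiniteDimensional.of_finrank_pos (hfin ▸ h)
  let y : L := ⟨x, hx⟩
  have hxy : algebraMap L U y = x := rfl
  refine ⟨(IsIntegral.of_finite A y).map (IsScalarTower.toAlgHom A L U), ?_⟩
  rw [← hxy, minpoly.algebraMap_eq (algebraMap L U).injective, ← hfin]
  exact minpoly.natDegree_le y

/-- An element of uniformly bounded degree over a decreasing sequence of subfields is algebraic
over a finitely generated subfield of all of them. -/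
theorem exists_finite_mem_algClosure {D : ℕ → Subfield U} (hD : Antitone D) {x : U} {C : ℕ}
    (hx : ∀ m, IsIntegral (D m) x ∧ (minpoly (D m) x).natDegree ≤ C) :
    ∃ t : Set U, t.Finite ∧ (∀ m, t ⊆ D m) ∧ x ∈ (closure t).algClosure := by
  let P : ℕ → Polynomial U := fun m => (minpoly (D m) x).map (D m).subtype
  have hmonic : ∀ m, (P m).Monic := fun m => (minpoly.monic (hx m).1).map _
  have hdeg : ∀ m, (P m).natDegree = (minpoly (D m) x).natDegree := fun m =>
    Polynomial.natDegree_map _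
  have hroot : ∀ m, (P m).eval x = 0 := fun m => by
    rw [Polynomial.eval_map]
    exact minpoly.aeval (D m) x
  have hdvd : ∀ m n, m ≤ n → P m ∣ P n := by
    intro m n hmn
    have h₁ : minpoly (D m) x ∣ (minpoly (D n) x).map (inclusion (hD hmn)) := by
      apply minpoly.dvd
      rw [Polynomial.aeval_def, Polynomial.eval₂_map]
      exact minpoly.aeval (D n) x
    have h₂ := Polynomial.map_dvd (D m).subtype h₁
    rw [Polynomial.map_map] at h₂
    exact h₂
  have hmono : Monotone fun m => (P m).natDegree := fun m n hmn =>
    Polynomial.natDegree_le_of_dvd (hdvd m n hmn) (hmonic n).ne_zero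
  obtain ⟨b, N, hN⟩ := converges_of_monotone_of_bounded (c := C) hmono
    fun m => (hdeg m).trans_le (hx m).2
  have hconst : ∀ m, N ≤ m → P m = P N := fun m hm =>
    (Polynomial.eq_of_dvd_of_natDegree_le_of_leadingCoeff (hdvd N m hm)
      ((hN m hm).trans (hN N le_rfl).symm).le
      ((hmonic N).leadingCoeff.trans (hmonic m).leadingCoeff.symm)).symm
  have hcoeff : ∀ m, ((P N).coeffs : Set U) ⊆ D m := by
    intro m y hy
    obtain ⟨k, -, rfl⟩ := Polynomial.mem_coeffs_iff.1 hy
    rw [← hconst _ (le_max_left N m), Polynomial.coeff_map]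
    exact hD (le_max_right N m) ((minpoly (D (max N m)) x).coeff k).2
  refine ⟨(P N).coeffs, Finset.finite_toSet _, hcoeff, ?_⟩
  have hlift : P N ∈ Polynomial.lifts (closure ((P N).coeffs : Set U)).subtype := by
    rw [Polynomial.lifts_iff_coeffs_subset_range]
    exact fun y hy => ⟨⟨y, subset_closure hy⟩, rfl⟩
  obtain ⟨q, hq⟩ := (Polynomial.mem_lifts _).1 hlift
  refine mem_algClosure.2
    ⟨q, fun h => (hmonic N).ne_zero (by rw [← hq, h, Polynomial.map_zero]), ?_⟩
  have := hroot N
  rw [← hq, Polynomial.eval_map] at this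
  exact this

theorem mem_algClosure_sup_closure_iff (K : Subfield U) (s : Set U) {x : U} :
    x ∈ (K ⊔ closure s).algClosure ↔ x ∈ (AlgebraicIndependent.matroid K U).closure s := by
  rw [AlgebraicIndependent.matroid_closure_eq, mem_algClosure, ← toSubfield_adjoin]
  exact IntermediateField.isAlgebraic_adjoin_iff

/-- If an automorphism preserving `K` maps a finite set `s` into `K(s)^alg`, then `s` is
contained in `K(σ(s))^alg`. -/
theorem subset_algClosure_of_image_subset {K : Subfield U} (σ : U ≃+* U)
    (hK : K.map σ.toRingHom = K) {s : Set U} (hs : s.Finite)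
    (h : σ '' s ⊆ (K ⊔ closure s).algClosure) :
    s ⊆ (K ⊔ closure (σ '' s)).algClosure := by
  let M := AlgebraicIndependent.matroid K U
  have hclos : σ '' s ⊆ M.closure s := fun x hx => (mem_algClosure_sup_closure_iff K s).1 (h hx)
  obtain ⟨I, hI⟩ := M.exists_isBasis' s
  have hind : M.Indep (σ '' I) := by
    let f : K →+* K := (σ.toRingHom.comp K.subtype).codRestrict K fun y => by
      have : σ y ∈ K.map σ.toRingHom := ⟨y, y.2, rfl⟩
      rwa [hK] at this
    have hf : Function.Surjective f := by
      intro y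
      have hy : (y : U) ∈ K.map σ.toRingHom := hK.symm ▸ y.2
      obtain ⟨z, hz, hzy⟩ := hy
      exact ⟨⟨z, hz⟩, Subtype.ext hzy⟩
    have h₁ : AlgebraicIndependent K ((↑) : I → U) := hI.indep
    have h₂ := h₁.ringHom_of_comp_eq f σ hf σ.injective rfl
    have h₃ : AlgebraicIndependent K ((↑) : Set.range (σ ∘ ((↑) : I → U)) → U) :=
      AlgebraicIndependent.coe_range h₂
    rwa [Set.range_comp, Subtype.range_coe] at h₃
  have hrk : M.eRk (σ '' s ∪ s) ≤ M.eRk (σ '' s) := by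
    calc M.eRk (σ '' s ∪ s) ≤ M.eRk (M.closure s) :=
          M.eRk_mono (Set.union_subset hclos (M.subset_closure s (Set.subset_univ s)))
      _ = M.eRk s := M.eRk_closure_eq s
      _ = I.encard := hI.eRk_eq_encard
      _ = (σ '' I).encard := (σ.injective.encard_image I).symm
      _ = M.eRk (σ '' I) := hind.eRk_eq_encard.symm
      _ ≤ M.eRk (σ '' s) := M.eRk_mono (Set.image_mono hI.subset)
  have heq := (M.isRkFinite_of_finite (hs.image σ)).closure_eq_closure_of_subset_of_eRk_ge_eRk
    Set.subset_union_left hrk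
  intro x hx
  refine (mem_algClosure_sup_closure_iff K _).2 ?_
  change x ∈ M.closure (σ '' s)
  rw [heq]
  exact M.subset_closure _ (Set.subset_univ _) (Or.inr hx)

end Subfield

namespace Subfield

open Set

variable [Field U] {σ : U ≃+* U} {A B E E' K W : Subfield U} {s t : Set ℤ}

/-- The translate `σ^i(A)` of a subfield. -/
def shift (σ : U ≃+* U) (i : ℤ) (A : Subfield U) : Subfield U := A.map (σ ^ i).toRingHom

theorem mem_shift {i : ℤ} {x : U} : x ∈ shift σ i A ↔ ∃ y ∈ A, (σ ^ i) y = x := Iff.rfl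

theorem shift_shift (i j : ℤ) (A : Subfield U) : shift σ i (shift σ j A) = shift σ (i + j) A := by
  rw [shift, shift, shift, map_map, zpow_add]
  rfl

theorem shift_zero (A : Subfield U) : shift σ 0 A = A := by
  ext x
  simp [mem_shift]

theorem shift_mono (i : ℤ) (h : A ≤ B) : shift σ i A ≤ shift σ i B :=
  (gc_map_comap _).monotone_l h

theorem shift_sup (i : ℤ) (A B : Subfield U) :
    shift σ i (A ⊔ B) = shift σ i A ⊔ shift σ i B := map_sup _ _ _

theorem shift_closure (i : ℤ) (u : Set U) :
    shift σ i (closure u) = closure ((σ ^ i) '' u) := RingHom.map_field_closure _ _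

theorem shift_algClosure_le (i : ℤ) (A : Subfield U) :
    shift σ i A.algClosure ≤ (shift σ i A).algClosure := map_algClosure A (σ ^ i)

theorem shift_natCast_eq (h : A.map σ.toRingHom = A) (n : ℕ) : shift σ n A = A := by
  induction n with
  | zero => exact shift_zero A
  | succ n ih =>
    have h₁ : shift σ 1 A = A := by rw [shift, zpow_one, h]
    rw [Nat.cast_succ, ← shift_shift, h₁, ih]

theorem shift_eq_of_map_eq (h : A.map σ.toRingHom = A) (i : ℤ) : shift σ i A = A := by
  obtain ⟨n, rfl | rfl⟩ := i.eq_nat_or_neg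
  · exact shift_natCast_eq h n
  · conv_lhs => rw [← shift_natCast_eq h n]
    rw [shift_shift, neg_add_cancel, shift_zero]

theorem relfinrank_shift (i : ℤ) (A B : Subfield U) :
    (shift σ i A).relfinrank (shift σ i B) = A.relfinrank B :=
  relfinrank_map_map A B _

/-- The compositum of the translates `σ^i(E)` for `i ∈ s`. -/
def win (σ : U ≃+* U) (E : Subfield U) (s : Set ℤ) : Subfield U := ⨆ i ∈ s, shift σ i E

theorem shift_le_win {i : ℤ} (h : i ∈ s) : shift σ i E ≤ win σ E s :=
  le_iSup₂_of_le i h le_rfl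

theorem win_le : win σ E s ≤ A ↔ ∀ i ∈ s, shift σ i E ≤ A := iSup₂_le_iff

theorem win_mono (h : s ⊆ t) : win σ E s ≤ win σ E t :=
  win_le.2 fun _ hi => shift_le_win (h hi)

theorem win_mono_left (h : E ≤ E') : win σ E s ≤ win σ E' s :=
  win_le.2 fun i hi => (shift_mono i h).trans (shift_le_win hi)

theorem win_union (E : Subfield U) (s t : Set ℤ) : win σ E (s ∪ t) = win σ E s ⊔ win σ E t := by
  refine le_antisymm (win_le.2 ?_)
    (sup_le (win_mono subset_union_left) (win_mono subset_union_right))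
  rintro i (hi | hi)
  · exact (shift_le_win hi).trans le_sup_left
  · exact (shift_le_win hi).trans le_sup_right

theorem win_singleton (E : Subfield U) (i : ℤ) : win σ E {i} = shift σ i E := by
  simp [win]

theorem le_win (h : 0 ∈ s) : E ≤ win σ E s := by
  conv_lhs => rw [← shift_zero (σ := σ) E]
  exact shift_le_win h

theorem shift_win_le {j : ℤ} (h : ∀ i ∈ s, j + i ∈ t) : shift σ j (win σ E s) ≤ win σ E t := by
  refine map_le_iff_le_comap.2 (win_le.2 fun i hi => map_le_iff_le_comap.1 ?_)
  change shift σ j (shift σ i E) ≤ _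
  rw [shift_shift]
  exact shift_le_win (h i hi)

theorem shift_win {j : ℤ} (h : ∀ i, i ∈ s ↔ j + i ∈ t) : shift σ j (win σ E s) = win σ E t := by
  refine le_antisymm (shift_win_le fun i => (h i).1) (win_le.2 fun i hi => ?_)
  have : shift σ i E = shift σ j (shift σ (i - j) E) := by rw [shift_shift, add_sub_cancel]
  rw [this]
  exact shift_mono j (shift_le_win ((h _).2 (by rwa [add_sub_cancel])))

theorem win_win_le {r : Set ℤ} (h : ∀ i ∈ t, ∀ j ∈ s, i + j ∈ r) :
    win σ (win σ E s) t ≤ win σ E r :=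
  win_le.2 fun i hi => shift_win_le (h i hi)

theorem win_Icc_win_Icc {a b c d : ℤ} (hab : a ≤ b) (hcd : c ≤ d) :
    win σ (win σ E (Icc a b)) (Icc c d) = win σ E (Icc (a + c) (b + d)) := by
  refine le_antisymm (win_win_le ?_) (win_le.2 fun i hi => ?_)
  · simp only [mem_Icc]
    omega
  · rw [mem_Icc] at hi
    let j := max c (i - b)
    have : shift σ i E = shift σ j (shift σ (i - j) E) := by rw [shift_shift, add_sub_cancel]
    rw [this]
    refine (shift_mono j (shift_le_win ?_)).trans (shift_le_win ?_)
    · rw [mem_Icc]; omega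
    · rw [mem_Icc]; omega

theorem relfinrank_win_shift {s' t' : Set ℤ} (j : ℤ) (hs : ∀ i, i ∈ s ↔ j + i ∈ s')
    (ht : ∀ i, i ∈ t ↔ j + i ∈ t') :
    (win σ E s').relfinrank (win σ E' t') = (win σ E s).relfinrank (win σ E' t) := by
  rw [← shift_win hs, ← shift_win ht, relfinrank_shift]

theorem exists_mem_win_inter_Icc {x : U} (hx : x ∈ win σ E s) :
    ∃ N : ℕ, ∀ n : ℕ, N ≤ n → x ∈ win σ E (s ∩ Icc (-n) n) := by
  have hmono : Monotone fun n : ℕ => win σ E (s ∩ Icc (-n) n) := fun m n hmn =>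
    win_mono (inter_subset_inter_right s (Icc_subset_Icc (by omega) (by omega)))
  have hle : win σ E s ≤ ⨆ n : ℕ, win σ E (s ∩ Icc (-n) n) := win_le.2 fun i hi =>
    le_iSup_of_le i.natAbs (shift_le_win ⟨hi, by rw [mem_Icc]; omega⟩)
  obtain ⟨N, hN⟩ := (mem_iSup_of_directed hmono.directed_le).1 (hle hx)
  exact ⟨N, fun n hn => hmono hn hN⟩

theorem exists_subset_win_inter_Icc {u : Set U} (hu : u.Finite) (h : u ⊆ win σ E s) :
    ∃ N : ℕ, ∀ n : ℕ, N ≤ n → u ⊆ win σ E (s ∩ Icc (-n) n) := by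
  induction u, hu using Set.Finite.induction_on with
  | empty => exact ⟨0, fun _ _ => empty_subset _⟩
  | insert _ _ ih =>
    obtain ⟨N, hN⟩ := ih ((subset_insert _ _).trans h)
    obtain ⟨M, hM⟩ := exists_mem_win_inter_Icc (h (mem_insert _ _))
    exact ⟨max N M, fun n hn => insert_subset (hM n (le_of_max_le_right hn))
      (hN n (le_of_max_le_left hn))⟩

/-- `E` is a finitely generated extension of `K` inside `W` over which `W` is algebraic. -/
structure IsModel (K W E : Subfield U) : Prop where
  base_le : K ≤ E
  fg : ∃ u : Set U, u.Finite ∧ E = K ⊔ closure u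
  le : E ≤ W
  alg : W ≤ E.algClosure

theorem IsModel.relfinrank_pos (h : IsModel K W E) (h' : IsModel K W E') (hle : E ≤ E') :
    0 < E.relfinrank E' := by
  obtain ⟨u, hu, rfl⟩ := h'.fg
  have : K ⊔ closure u = E ⊔ closure u :=
    le_antisymm (sup_le_sup_right h.base_le _) (sup_le hle le_sup_right)
  rw [this]
  refine relfinrank_sup_closure_pos hu ?_
  exact closure_le.1 (le_sup_right.trans (h'.le.trans h.alg))

theorem base_le_win (hK : ∀ i, shift σ i K = K) (h : K ≤ E) (hs : s.Nonempty) :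
    K ≤ win σ E s := by
  obtain ⟨i, hi⟩ := hs
  rw [← hK i]
  exact (shift_mono i h).trans (shift_le_win hi)

theorem IsModel.isModel_win (hK : ∀ i, shift σ i K = K) (hW : ∀ i, shift σ i W = W)
    (h : IsModel K W E) (hs : s.Nonempty) (hfin : s.Finite) : IsModel K W (win σ E s) where
  base_le := base_le_win hK h.base_le hs
  fg := by
    obtain ⟨u, hu, hE⟩ := h.fg
    have hsh : ∀ i, shift σ i E = K ⊔ closure ((σ ^ i) '' u) := fun i => by
      rw [hE, shift_sup, hK, shift_closure]
    refine ⟨⋃ i ∈ s, (σ ^ i) '' u, hfin.biUnion fun i _ => hu.image _, le_antisymm ?_ ?_⟩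
    · refine win_le.2 fun i hi => ?_
      rw [hsh i]
      refine sup_le le_sup_left (le_trans ?_ le_sup_right)
      exact closure_mono fun x hx => mem_iUnion₂.2 ⟨i, hi, hx⟩
    · refine sup_le (base_le_win hK h.base_le hs) (closure_le.2 fun x hx => ?_)
      obtain ⟨i, hi, hx⟩ := mem_iUnion₂.1 hx
      refine shift_le_win hi ?_
      rw [hsh i]
      exact closure_le.1 le_sup_right hx
  le := win_le.2 fun i _ => (shift_mono i h.le).trans (hW i).le
  alg := by
    obtain ⟨i, hi⟩ := hs
    rw [← hW i]
    exact (shift_mono i h.alg).trans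
      ((shift_algClosure_le i E).trans (algClosure_mono (shift_le_win hi)))

theorem IsModel.exists_le_win_inter_Icc (hK : ∀ i, shift σ i K = K) (h : IsModel K W E)
    (h' : IsModel K W E') (hs : s.Nonempty) (hle : E' ≤ win σ E s) :
    ∃ N : ℕ, ∀ n : ℕ, N ≤ n → E' ≤ win σ E (s ∩ Icc (-n) n) := by
  obtain ⟨u, hu, rfl⟩ := h'.fg
  obtain ⟨N, hN⟩ := exists_subset_win_inter_Icc hu (closure_le.1 (le_sup_right.trans hle))
  obtain ⟨i, hi⟩ := hs
  refine ⟨max N i.natAbs, fun n hn => sup_le (base_le_win hK h.base_le ⟨i, hi, ?_⟩)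
    (closure_le.2 (hN n (le_of_max_le_left hn)))⟩
  rw [mem_Icc]
  omega

theorem IsModel.relfinrank_win_union_pos (hK : ∀ i, shift σ i K = K)
    (hW : ∀ i, shift σ i W = W) (h : IsModel K W E) (hs : s.Nonempty) (ht : t.Finite) :
    0 < (win σ E s).relfinrank (win σ E (s ∪ t)) := by
  obtain ⟨i, hi⟩ := hs
  have h₁ : IsModel K W (win σ E {i}) :=
    h.isModel_win hK hW (singleton_nonempty i) (finite_singleton i)
  have h₂ : IsModel K W (win σ E ({i} ∪ t)) :=
    h.isModel_win hK hW ⟨i, Or.inl rfl⟩ ((finite_singleton i).union ht)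
  have hle : win σ E {i} ≤ win σ E ({i} ∪ t) := win_mono subset_union_left
  have := (relfinrank_sup_right_le hle (h₁.relfinrank_pos h₂ hle) (win σ E s)).1
  rwa [← win_union, ← win_union, union_eq_self_of_subset_left (singleton_subset_iff.2 hi),
    union_right_comm, union_eq_self_of_subset_left (singleton_subset_iff.2 hi)] at this

end Subfield

namespace Subfield

open Set

variable [Field U] {σ : U ≃+* U} {A B E E' K W : Subfield U} {r s t : Set ℤ}

theorem IsModel.win_le (hW : ∀ i, shift σ i W = W) (h : IsModel K W E) (s : Set ℤ) :
    win σ E s ≤ W :=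
  Subfield.win_le.2 fun i _ => (shift_mono i h.le).trans (hW i).le

theorem IsModel.relfinrank_win_pos (hK : ∀ i, shift σ i K = K) (hW : ∀ i, shift σ i W = W)
    (h : IsModel K W E) (hs : s.Nonempty) (hst : s ⊆ t) (hfin : (t \ s).Finite) :
    0 < (win σ E s).relfinrank (win σ E t) := by
  rw [← union_sdiff_cancel hst]
  exact h.relfinrank_win_union_pos hK hW hs hfin

theorem IsModel.relfinrank_win_union_le (hK : ∀ i, shift σ i K = K) (hW : ∀ i, shift σ i W = W)
    (h : IsModel K W E) (hs : s.Nonempty) (hst : s ⊆ t) (hfin : (t \ s).Finite) (r : Set ℤ) :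
    (win σ E (s ∪ r)).relfinrank (win σ E (t ∪ r)) ≤ (win σ E s).relfinrank (win σ E t) := by
  rw [win_union, win_union]
  exact (relfinrank_sup_right_le (win_mono hst) (h.relfinrank_win_pos hK hW hs hst hfin) _).2

/-- The compositum of the translates `σ^i(E)` for `i` outside the open interval `(-m, j)`. -/
def outer (σ : U ≃+* U) (E : Subfield U) (m j : ℤ) : Subfield U := win σ E (Iic (-m) ∪ Ici j)

theorem outer_anti {m j m' j' : ℤ} (hm : m ≤ m') (hj : j ≤ j') :
    outer σ E m' j' ≤ outer σ E m j :=
  win_mono (union_subset_union (Iic_subset_Iic.2 (by omega)) (Ici_subset_Ici.2 hj))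

theorem outer_diff_finite (m j k : ℤ) : ((Iic (-m) ∪ Ici j) \ (Iic (-m) ∪ Ici k) : Set ℤ).Finite :=
  (finite_Icc j k).subset fun i hi => by
    simp only [Set.mem_sdiff, mem_union, mem_Iic, mem_Ici] at hi
    rw [mem_Icc]
    omega

theorem IsModel.exists_relfinrank_outer_eq (hK : ∀ i, shift σ i K = K)
    (hW : ∀ i, shift σ i W = W) (h : IsModel K W E) :
    ∃ (m₀ : ℕ) (b : ℕ), ∀ m : ℕ, m₀ ≤ m → ∀ j : ℕ,
      (outer σ E m j).relfinrank (outer σ E m 0) = b ^ j := by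
  have hsub : ∀ m : ℤ, (Iic (-m) ∪ Ici 1 : Set ℤ) ⊆ Iic (-m) ∪ Ici 0 := fun m =>
    union_subset_union_right _ (Ici_subset_Ici.2 zero_le_one)
  have hmono : Monotone fun m : ℕ => (outer σ E m 1).relfinrank (outer σ E m 0) := by
    intro m n hmn
    have := h.relfinrank_win_union_le hK hW ⟨1, Or.inr (mem_Ici.2 le_rfl)⟩ (hsub n)
      (outer_diff_finite n 0 1)
      (Iic (-m))
    rw [union_right_comm, union_right_comm _ (Ici 0),
      union_eq_self_of_subset_left (Iic_subset_Iic.2 (by omega : -(n : ℤ) ≤ -m))] at this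
    exact this
  obtain ⟨b, m₀, hb⟩ := converges_of_monotone_of_bounded hmono fun m => by
    have := h.relfinrank_win_union_le hK hW ⟨1, mem_Ici.2 le_rfl⟩ (Ici_subset_Ici.2 zero_le_one)
      ((finite_Icc (0 : ℤ) 1).subset fun i hi => by
        simp only [Set.mem_sdiff, mem_Ici] at hi
        rw [mem_Icc]
        omega) (Iic (-m))
    rw [union_comm, union_comm (Ici 0)] at this
    exact this
  refine ⟨m₀, b, fun m hm j => ?_⟩
  induction j with
  | zero => simp
  | succ j ih =>
    have hstep : (outer σ E m (j + 1)).relfinrank (outer σ E m j) = b := by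
      rw [← hb (m + j) (by omega)]
      refine relfinrank_win_shift j ?_ ?_ <;>
      · intro i
        simp only [mem_union, mem_Iic, mem_Ici]
        omega
    rw [Nat.cast_succ, ← relfinrank_mul_relfinrank (outer_anti le_rfl (by omega : (j : ℤ) ≤ j + 1))
      (outer_anti le_rfl (by omega)), hstep, ih, pow_succ']

theorem IsModel.exists_forall_le_outer (hK : ∀ i, shift σ i K = K)
    (hW : ∀ i, shift σ i W = W) (h : IsModel K W E) :
    ∃ E', IsModel K W E' ∧ ∀ m : ℕ, E' ≤ outer σ E m m := by
  obtain ⟨m₀, b, hb⟩ := h.exists_relfinrank_outer_eq hK hW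
  let C := (win σ E (Iic (-m₀))).relfinrank (win σ E (Iic (-m₀) ∪ {0}))
  have hdeg : ∀ x ∈ E, ∀ k : ℕ, IsIntegral (outer σ E (m₀ + k) (m₀ + k)) x ∧
      (minpoly (outer σ E (m₀ + k) (m₀ + k)) x).natDegree ≤ C := by
    intro x hx k
    let S : Set ℤ := Iic (-(m₀ + k)) ∪ Ici (m₀ + k)
    have hpos : 0 < (win σ E S).relfinrank (win σ E (S ∪ {0})) :=
      h.relfinrank_win_union_pos hK hW ⟨m₀ + k, Or.inr (mem_Ici.2 le_rfl)⟩ (finite_singleton 0)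
    have hx' := natDegree_minpoly_le_relfinrank (win_mono subset_union_left) hpos
      (le_win (mem_union_right S (mem_singleton 0)) hx)
    refine ⟨hx'.1, hx'.2.trans ?_⟩
    have hsub : S ∪ {0} ⊆ Iic (-(m₀ + k)) ∪ Ici 0 := fun i hi => by
      simp only [S, mem_union, mem_Iic, mem_Ici, mem_singleton_iff] at hi ⊢
      omega
    have hout : ∀ j : ℤ, win σ E (Iic (-(m₀ + k)) ∪ Ici j) ⊔ win σ E (Iic (-m₀)) =
        outer σ E m₀ j := fun j => by
      rw [← win_union, union_right_comm, union_eq_self_of_subset_left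
        (Iic_subset_Iic.2 (by omega : -(m₀ + k : ℤ) ≤ -m₀))]
      rfl
    have e₁ := hb (m₀ + k) (by omega) (m₀ + k)
    have e₂ := hb m₀ le_rfl (m₀ + k)
    push_cast at e₁ e₂
    have hkey := relfinrank_sup_eq_of_le (D := win σ E (Iic (-m₀))) (win_mono subset_union_left)
      (win_mono hsub) (h.relfinrank_win_pos hK hW ⟨m₀ + k, Or.inr (mem_Ici.2 le_rfl)⟩
        (subset_union_left.trans hsub) (outer_diff_finite _ _ _)) (by
        rw [hout, hout, e₂]
        exact e₁.le)
    rw [← hkey, ← win_union, ← win_union]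
    have hle := h.relfinrank_win_union_le hK hW (s := Iic (-(m₀ : ℤ))) ⟨_, mem_Iic.2 le_rfl⟩
      subset_union_left (t := Iic (-m₀) ∪ {0}) ((finite_singleton 0).subset fun i hi => by
        simp only [Set.mem_sdiff, mem_union] at hi
        tauto) S
    rw [union_right_comm _ {0} S] at hle
    rwa [union_right_comm S, union_comm S]
  have hanti : Antitone fun k : ℕ => outer σ E (m₀ + k) (m₀ + k) := fun k l hkl =>
    outer_anti (by omega) (by omega)
  have hex : ∀ x ∈ E, ∃ t : Set U, t.Finite ∧ (∀ m : ℕ, t ⊆ outer σ E (m₀ + m) (m₀ + m)) ∧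
      x ∈ (closure t).algClosure := fun x hx => exists_finite_mem_algClosure hanti (hdeg x hx)
  choose! t ht₁ ht₂ ht₃ using hex
  obtain ⟨u, hu, rfl⟩ := h.fg
  have huE : ∀ x ∈ u, x ∈ K ⊔ closure u := fun x hx => closure_le.1 le_sup_right hx
  have hle : ∀ m : ℕ, K ⊔ closure (⋃ x ∈ u, t x) ≤ outer σ (K ⊔ closure u) m m := fun m => by
    refine sup_le (base_le_win hK h.base_le ⟨m, Or.inr (mem_Ici.2 le_rfl)⟩)
      (closure_le.2 (iUnion₂_subset fun x hx y hy => ?_))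
    exact outer_anti (by omega) (by omega) (ht₂ x (huE x hx) m hy)
  refine ⟨_, ⟨le_sup_left, ⟨_, hu.biUnion fun x hx => ht₁ x (huE x hx), rfl⟩,
    (hle 0).trans (h.win_le hW _), h.alg.trans (algClosure_le_of_le ?_)⟩, hle⟩
  refine sup_le (le_sup_left.trans (le_algClosure _)) (closure_le.2 fun x hx => ?_)
  refine algClosure_mono (le_trans (closure_mono ?_) le_sup_right) (ht₃ x (huE x hx))
  exact fun y hy => mem_iUnion₂.2 ⟨x, hx, hy⟩

end Subfield

namespace Subfield

open Set

variable [Field U] {σ : U ≃+* U} {A B E E' G K W : Subfield U} {r s t : Set ℤ}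

/-- The degree of `E(σ(E), …, σ^{k+1}(E))` over `E(σ(E), …, σ^k(E))`. -/
noncomputable def gap (σ : U ≃+* U) (E : Subfield U) (k : ℕ) : ℕ :=
  (win σ E (Icc 0 k)).relfinrank (win σ E (Icc 0 (k + 1)))

theorem IsModel.gap_pos (hK : ∀ i, shift σ i K = K) (hW : ∀ i, shift σ i W = W)
    (h : IsModel K W E) (k : ℕ) : 0 < gap σ E k :=
  h.relfinrank_win_pos hK hW (nonempty_Icc.2 (by omega)) (Icc_subset_Icc le_rfl (by omega))
    ((finite_Icc _ _).subset sdiff_subset)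

theorem relfinrank_win_Icc_eq_gap {i j : ℤ} {k : ℕ} (h : j = i + k) :
    (win σ E (Icc i j)).relfinrank (win σ E (Icc i (j + 1))) = gap σ E k := by
  refine relfinrank_win_shift i ?_ ?_ <;>
  · intro l
    simp only [mem_Icc]
    omega

theorem gap_win_Icc {i j : ℤ} {k l : ℕ} (h : j = i + k) :
    gap σ (win σ E (Icc i j)) l = gap σ E (k + l) := by
  rw [gap, win_Icc_win_Icc (by omega) (by omega), win_Icc_win_Icc (by omega) (by omega),
    ← add_assoc]
  exact relfinrank_win_Icc_eq_gap (by omega)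

theorem IsModel.gap_le (hK : ∀ i, shift σ i K = K) (hW : ∀ i, shift σ i W = W)
    (h : IsModel K W E) (k : ℕ) : gap σ E k ≤ gap σ E 0 := by
  have := h.relfinrank_win_union_le hK hW (s := Icc (k : ℤ) k) (t := Icc (k : ℤ) (k + 1))
    (nonempty_Icc.2 le_rfl) (Icc_subset_Icc le_rfl (by omega))
    ((finite_Icc _ _).subset sdiff_subset) (Icc 0 k)
  rw [relfinrank_win_Icc_eq_gap (k := 0) (by simp)] at this
  refine le_trans (le_of_eq ?_) this
  rw [gap]
  congr 2
  · ext i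
    simp only [mem_union, mem_Icc]
    omega
  · ext i
    simp only [mem_union, mem_Icc]
    omega

theorem exists_gap_minimal {P : Subfield U → Prop} (h : ∃ E, P E) :
    ∃ E, P E ∧ ∀ E', P E' → gap σ E 0 ≤ gap σ E' 0 := by
  obtain ⟨E, hE, hmin⟩ := (measure fun E => gap σ E 0).wf.has_min {E | P E} h
  exact ⟨E, hE, fun E' hE' => not_lt.1 (hmin E' hE')⟩

/-- If the gap of `G` is at most all the gaps of `E`, then `[G(…, σ^k(G)) : E(…, σ^k(E))]` does
not grow with `k`. -/
theorem IsModel.relfinrank_win_le_of_gap_le (hK : ∀ i, shift σ i K = K)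
    (hW : ∀ i, shift σ i W = W) (h : IsModel K W E) (hG : IsModel K W G) (hle : E ≤ G)
    (hgap : ∀ k, gap σ G 0 ≤ gap σ E k) {i j : ℤ} (hij : i ≤ j) :
    0 < (win σ E (Icc i j)).relfinrank (win σ G (Icc i j)) ∧
      (win σ E (Icc i j)).relfinrank (win σ G (Icc i j)) ≤ E.relfinrank G := by
  refine ⟨(h.isModel_win hK hW (nonempty_Icc.2 hij) (finite_Icc _ _)).relfinrank_pos
    (hG.isModel_win hK hW (nonempty_Icc.2 hij) (finite_Icc _ _)) (win_mono_left hle), ?_⟩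
  obtain ⟨k, rfl⟩ := Int.le.dest hij
  clear hij
  induction k with
  | zero => simp [win_singleton, relfinrank_shift]
  | succ k ih =>
    refine le_trans ?_ ih
    have hsub : Icc i (i + k) ⊆ Icc i (i + k + 1) := Icc_subset_Icc le_rfl (by omega)
    have e₁ := relfinrank_mul_relfinrank (win_mono_left (σ := σ) hle)
      (win_mono (σ := σ) (E := G) hsub)
    have e₂ := relfinrank_mul_relfinrank (win_mono (σ := σ) (E := E) hsub)
      (win_mono_left (σ := σ) hle)
    rw [relfinrank_win_Icc_eq_gap rfl] at e₁ e₂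
    rw [Nat.cast_succ, ← add_assoc]
    refine Nat.le_of_mul_le_mul_left ?_ (h.gap_pos hK hW k)
    rw [e₂, ← e₁, mul_comm]
    exact Nat.mul_le_mul_right _ ((hG.gap_le hK hW k).trans (hgap k))

theorem shift_outer_le {i m j m' j' : ℤ} (hm : m' + i ≤ m) (hj : j' - i ≤ j) :
    shift σ i (outer σ E m j) ≤ outer σ E m' j' :=
  shift_win_le fun l hl => by
    simp only [mem_union, mem_Iic, mem_Ici] at hl ⊢
    omega

theorem win_Icc_le_outer (h : ∀ m : ℕ, E ≤ outer σ G m m) {a b : ℤ} (m : ℕ) :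
    win σ E (Icc a b) ≤ outer σ G m m :=
  win_le.2 fun i hi => by
    rw [mem_Icc] at hi
    exact (shift_mono i (h (m + i.natAbs))).trans (shift_outer_le (by omega) (by omega))

theorem IsModel.relfinrank_outer_win_univ_le (hK : ∀ i, shift σ i K = K)
    (hW : ∀ i, shift σ i W = W) (h : IsModel K W E) (hG : IsModel K W G) (hle : E ≤ G)
    (hgap : ∀ k, gap σ G 0 ≤ gap σ E k) (hout : ∀ m : ℕ, E ≤ outer σ G m m) (m : ℕ) :
    0 < (outer σ E m m).relfinrank (win σ E univ) ∧
      (outer σ E m m).relfinrank (win σ E univ) ≤ E.relfinrank G * E.relfinrank G := by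
  obtain ⟨N, hN⟩ := hG.exists_le_win_inter_Icc hK (h.isModel_win hK hW
    (nonempty_Icc.2 (by omega : -(m : ℤ) ≤ m)) (finite_Icc _ _))
    ⟨m, Or.inr (mem_Ici.2 le_rfl)⟩ (win_Icc_le_outer hout m)
  let n := max N m
  let I : Set ℤ := Icc (-n) (-m)
  let J : Set ℤ := Icc m n
  have hI := h.relfinrank_win_le_of_gap_le hK hW hG hle hgap (by omega : -(n : ℤ) ≤ -m)
  have hJ := h.relfinrank_win_le_of_gap_le hK hW hG hle hgap (by omega : (m : ℤ) ≤ n)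
  have hI' := relfinrank_sup_right_le (win_mono_left hle) hI.1 (win σ E J)
  have hJ' := relfinrank_sup_right_le (win_mono_left hle) hJ.1 (win σ G I)
  rw [sup_comm, sup_comm _ (win σ G I)] at hJ'
  have hle₁ : win σ E I ⊔ win σ E J ≤ win σ G I ⊔ win σ E J :=
    sup_le_sup_right (win_mono_left hle) _
  have hle₂ : win σ G I ⊔ win σ E J ≤ win σ G I ⊔ win σ G J :=
    sup_le_sup_left (win_mono_left hle) _
  have hpos := relfinrank_pos_trans hle₁ hle₂ hI'.1 hJ'.1
  have hbound : (win σ E I ⊔ win σ E J).relfinrank (win σ G I ⊔ win σ G J) ≤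
      E.relfinrank G * E.relfinrank G := by
    rw [← relfinrank_mul_relfinrank hle₁ hle₂]
    exact Nat.mul_le_mul (hI'.2.trans hI.2) (hJ'.2.trans hJ.2)
  have hT := relfinrank_sup_right_le (hle₁.trans hle₂) hpos (outer σ E m m)
  have hET : win σ E I ⊔ win σ E J ≤ outer σ E m m := by
    rw [← win_union]
    refine win_mono fun i hi => ?_
    simp only [I, J, mem_union, mem_Icc, mem_Iic, mem_Ici] at hi ⊢
    omega
  rw [sup_eq_right.2 hET] at hT
  have huniv : win σ E univ ≤ win σ G I ⊔ win σ G J ⊔ outer σ E m m := by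
    have hcover : (univ : Set ℤ) = Icc (-(m : ℤ)) m ∪ (Iic (-m) ∪ Ici m) := by
      ext i
      simp only [mem_univ, true_iff, mem_union, mem_Icc, mem_Iic, mem_Ici]
      omega
    rw [hcover, win_union]
    refine sup_le (le_trans ?_ le_sup_left) le_sup_right
    rw [← win_union]
    refine (hN n (le_max_left _ _)).trans (win_mono fun i hi => ?_)
    simp only [I, J, mem_inter_iff, mem_union, mem_Icc, mem_Iic, mem_Ici] at hi ⊢
    omega
  have hsub : outer σ E m m ≤ win σ E univ := win_mono (subset_univ _)
  exact ⟨relfinrank_pos_left hsub huniv hT.1,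
    (relfinrank_mono_right hsub huniv hT.1).trans (hT.2.trans hbound)⟩

theorem le_outer_of_relfinrank_outer_le {C : ℕ}
    (h : ∀ m : ℕ, 0 < (outer σ E m m).relfinrank (win σ E univ) ∧
      (outer σ E m m).relfinrank (win σ E univ) ≤ C) (j : ℕ) : E ≤ outer σ E j j := by
  have hsub : ∀ m : ℕ, outer σ E m m ≤ win σ E univ := fun m => win_mono (subset_univ _)
  have hanti : ∀ {m n : ℕ}, m ≤ n → outer σ E n n ≤ outer σ E m m := fun hmn =>
    outer_anti (by omega) (by omega)
  have hmono : Monotone fun m : ℕ => (outer σ E m m).relfinrank (win σ E univ) := fun m n hmn =>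
    relfinrank_anti_left (hanti hmn) (hsub m) (h n).1
  obtain ⟨b, M, hM⟩ := converges_of_monotone_of_bounded hmono fun m => (h m).2
  have hle : outer σ E M M ≤ outer σ E (M + j : ℕ) (M + j : ℕ) := by
    have hmul := relfinrank_mul_relfinrank (hanti (Nat.le_add_right M j)) (hsub M)
    have e₁ : (outer σ E M M).relfinrank (win σ E univ) = b := hM M le_rfl
    have e₂ : (outer σ E (M + j : ℕ) (M + j : ℕ)).relfinrank (win σ E univ) = b :=
      hM (M + j) (by omega)
    rw [e₁, e₂] at hmul
    exact relfinrank_eq_one_iff.1 (Nat.eq_of_mul_eq_mul_right (e₁ ▸ (h M).1) (by rw [hmul, one_mul]))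
  have hE : E = shift σ (-(M : ℤ)) (shift σ M E) := by rw [shift_shift, neg_add_cancel, shift_zero]
  rw [hE]
  conv_rhs => rw [← hE]
  exact (shift_mono _ ((shift_le_win (Or.inr (mem_Ici.2 le_rfl))).trans hle)).trans
    (shift_outer_le (by omega) (by omega))

theorem IsModel.exists_forall_le_outer_self (hK : ∀ i, shift σ i K = K)
    (hW : ∀ i, shift σ i W = W) (h : IsModel K W E) :
    ∃ E', IsModel K W E' ∧ ∀ m : ℕ, E' ≤ outer σ E' m m := by
  obtain ⟨E, h, hmin⟩ := exists_gap_minimal (σ := σ) ⟨E, h⟩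
  obtain ⟨E', h', hout⟩ := h.exists_forall_le_outer hK hW
  obtain ⟨N, hN⟩ := h.exists_le_win_inter_Icc hK h' ⟨0, Or.inr (mem_Ici.2 le_rfl)⟩ (hout 0)
  let G := win σ E (Icc (-N) N)
  have hG : IsModel K W G := h.isModel_win hK hW (nonempty_Icc.2 (by omega)) (finite_Icc _ _)
  have hle : E' ≤ G := (hN N le_rfl).trans (win_mono inter_subset_right)
  have hgap : ∀ k, gap σ G 0 ≤ gap σ E' k := fun k => by
    refine ((gap_win_Icc (k := 2 * N) (by push_cast; ring)).trans_le (h.gap_le hK hW _)).trans ?_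
    rw [← add_zero k, ← gap_win_Icc (i := 0) rfl]
    exact hmin _ (h'.isModel_win hK hW (nonempty_Icc.2 (by omega)) (finite_Icc _ _))
  have hout' : ∀ m : ℕ, E' ≤ outer σ G m m := fun m =>
    (hout m).trans (win_mono_left (le_win (mem_Icc.2 (by omega))))
  exact ⟨E', h', le_outer_of_relfinrank_outer_le
    (h'.relfinrank_outer_win_univ_le hK hW hG hle hgap hout')⟩

theorem relfinrank_win_Icc_eq_pow {d : ℕ} (hd : ∀ k, gap σ E k = d) {i j : ℤ} (hij : i ≤ j)
    (n : ℕ) : (win σ E (Icc i j)).relfinrank (win σ E (Icc i (j + n))) = d ^ n := by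
  induction n with
  | zero => simp
  | succ n ih =>
    rw [Nat.cast_succ, ← add_assoc, ← relfinrank_mul_relfinrank
      (win_mono (Icc_subset_Icc le_rfl (by omega : j ≤ j + n)))
      (win_mono (Icc_subset_Icc le_rfl (by omega))), ih,
      relfinrank_win_Icc_eq_gap (k := (j + n - i).toNat) (by omega), hd, pow_succ]

theorem IsModel.shift_one_le (hK : ∀ i, shift σ i K = K) (hW : ∀ i, shift σ i W = W)
    (h : IsModel K W E) (hout : ∀ m : ℕ, E ≤ outer σ E m m) {d : ℕ} (hd : ∀ k, gap σ E k = d)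
    {l : ℕ} (hl : 0 < l) : shift σ 1 E ≤ E ⊔ shift σ l E := by
  have hle : win σ E {1} ≤ outer σ E 0 l := by
    rw [win_singleton]
    exact (shift_mono 1 (hout l)).trans (shift_outer_le (by omega) (by omega))
  obtain ⟨N, hN⟩ := h.exists_le_win_inter_Icc hK
    (h.isModel_win hK hW (singleton_nonempty 1) (finite_singleton _))
    ⟨l, Or.inr (mem_Ici.2 le_rfl)⟩ hle
  rw [win_singleton] at hN
  let n := l + N
  let X := win σ E (Icc (-n) 0)
  have hpos : ∀ {a b c : ℤ}, a ≤ b → b ≤ c →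
      0 < (win σ E (Icc a b)).relfinrank (win σ E (Icc a c)) := fun hab hbc =>
    h.relfinrank_win_pos hK hW (nonempty_Icc.2 hab) (Icc_subset_Icc le_rfl hbc)
      ((finite_Icc _ _).subset sdiff_subset)
  have hwin : ∀ {a b c d : ℤ}, a ≤ c → c ≤ b + 1 → b ≤ d →
      win σ E (Icc a b) ⊔ win σ E (Icc c d) = win σ E (Icc a d) := by
    intro a b c d h₁ h₂ h₃
    rw [← win_union]
    congr 1
    ext i
    simp only [mem_union, mem_Icc]
    omega
  have hl1 : shift σ l E = win σ E (Icc l l) := by rw [Icc_self, win_singleton]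
  have h01 : E = win σ E (Icc 0 0) := by rw [Icc_self, win_singleton, shift_zero]
  have hstep₁ : shift σ 1 E ≤ shift σ l E ⊔ X := by
    have hY := relfinrank_sup_right_le
      (win_mono (Icc_subset_Icc le_rfl (by omega))) (hpos le_rfl (by omega : (l : ℤ) ≤ l + N)) X
    have hYpow := relfinrank_win_Icc_eq_pow hd (le_refl (l : ℤ)) N
    have hC := relfinrank_win_Icc_eq_pow hd (by omega : -(n : ℤ) ≤ l) N
    have hAC : win σ E (Icc l l) ⊔ X ⊔ win σ E (Icc (-n) l) = win σ E (Icc (-n) l) :=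
      sup_eq_right.2 (sup_le (win_mono (Icc_subset_Icc (by omega) le_rfl))
        (win_mono (Icc_subset_Icc le_rfl (by omega))))
    have hBC : win σ E (Icc l (l + N)) ⊔ X ⊔ win σ E (Icc (-n) l) =
        win σ E (Icc (-n) (l + N)) := by
      rw [sup_assoc, sup_eq_right.2 (win_mono (Icc_subset_Icc le_rfl (by omega)) :
        X ≤ win σ E (Icc (-n) l)), sup_comm]
      exact hwin (by omega) (by omega) (by omega)
    have hinf := inf_sup_le_of_relfinrank_le (D := win σ E (Icc (-n) l))
      (sup_le_sup_right (win_mono (Icc_subset_Icc le_rfl (by omega))) X) hY.1 (by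
        rw [hAC, hBC, hC, ← hYpow]
        exact hY.2)
    rw [hl1]
    refine le_trans (le_inf ?_ ?_) hinf
    · rw [← win_union]
      refine (hN n (by omega)).trans (win_mono fun i hi => ?_)
      simp only [mem_inter_iff, mem_union, mem_Icc, mem_Iic, mem_Ici] at hi ⊢
      omega
    · rw [hAC]
      exact shift_le_win (mem_Icc.2 (by omega))
  have hBC : E ⊔ shift σ l E ≤ win σ E (Icc 0 l) :=
    sup_le (le_win (mem_Icc.2 (by omega))) (shift_le_win (mem_Icc.2 (by omega)))
  have hpow₁ := relfinrank_win_Icc_eq_pow hd (le_refl (0 : ℤ)) l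
  have hpow₂ := relfinrank_win_Icc_eq_pow hd (by omega : -(n : ℤ) ≤ 0) l
  rw [zero_add] at hpow₁ hpow₂
  have hdeg : E.relfinrank (win σ E (Icc 0 l)) ≤ (E ⊔ X).relfinrank (win σ E (Icc 0 l) ⊔ X) := by
    rw [sup_eq_right.2 (le_win (mem_Icc.2 (by omega)) : E ≤ X), sup_comm,
      hwin (by omega) (by omega) (by omega), hpow₂]
    rw [← h01] at hpow₁
    exact hpow₁.le
  have hEpos : 0 < E.relfinrank (win σ E (Icc 0 l)) := by
    have := hpos le_rfl (by omega : (0 : ℤ) ≤ l)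
    rwa [← h01] at this
  refine le_trans (le_inf (shift_le_win (mem_Icc.2 (by omega))) (hstep₁.trans
    (sup_le_sup_right le_sup_right X))) (inf_sup_le_of_relfinrank_le hBC
      (relfinrank_pos_right le_sup_left hBC hEpos)
      (relfinrank_le_sup_of_le le_sup_left hBC hEpos hdeg))

/-- If `W` has a model, then it has a model `E` with `σ(E) ⊆ E(σ^l(E))` for all `l > 0`. -/
theorem IsModel.exists_forall_shift_one_le (hK : ∀ i, shift σ i K = K)
    (hW : ∀ i, shift σ i W = W) (h : IsModel K W E) :
    ∃ E', IsModel K W E' ∧ ∀ l : ℕ, 0 < l → shift σ 1 E' ≤ E' ⊔ shift σ l E' := by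
  obtain ⟨E, ⟨h, hout⟩, hmin⟩ := exists_gap_minimal (σ := σ) (h.exists_forall_le_outer_self hK hW)
  refine ⟨E, h, fun l hl => h.shift_one_le hK hW hout (d := gap σ E 0) (fun k => ?_) hl⟩
  refine le_antisymm (h.gap_le hK hW k) ?_
  rw [← add_zero k, ← gap_win_Icc (i := 0) rfl]
  refine hmin _ ⟨h.isModel_win hK hW (nonempty_Icc.2 (by omega)) (finite_Icc _ _), fun m => ?_⟩
  exact (win_Icc_le_outer hout m).trans (win_mono_left (le_win (mem_Icc.2 (by omega))))

end Subfield

namespace Subfield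

open Set

variable [Field U] {σ : U ≃+* U} {F K : Subfield U}

theorem shift_natCast_le (h : shift σ 1 F ≤ F) (n : ℕ) : shift σ n F ≤ F := by
  induction n with
  | zero => exact (shift_zero F).le
  | succ n ih =>
    rw [Nat.cast_succ, ← shift_shift]
    exact (shift_mono _ h).trans ih

theorem shift_algClosure_le_of_le {i : ℤ} (h : shift σ i F ≤ F.algClosure) :
    shift σ i F.algClosure ≤ F.algClosure :=
  (shift_algClosure_le i F).trans (algClosure_le_of_le h)

/-- If `σ(u) ⊆ K(u)^alg` for a finite set `u`, then the field generated over `K` by all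
translates of `u` is algebraic over `K(u)`. -/
theorem isModel_win_univ (hK : K.map σ.toRingHom = K) {u : Set U} (hu : u.Finite)
    (h : σ '' u ⊆ (K ⊔ closure u).algClosure) :
    IsModel K (win σ (K ⊔ closure u) univ) (K ⊔ closure u) := by
  have hsh := shift_eq_of_map_eq hK
  let F := K ⊔ closure u
  have hF : ∀ i, shift σ i F = K ⊔ closure ((σ ^ i) '' u) := fun i => by
    rw [shift_sup, hsh, shift_closure]
  have h₁ : shift σ 1 F ≤ F.algClosure := by
    rw [hF, zpow_one]
    exact sup_le (le_sup_left.trans (le_algClosure F)) (closure_le.2 h)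
  have h₂ : shift σ (-1) F ≤ F.algClosure := by
    have : F ≤ (shift σ 1 F).algClosure := by
      rw [hF, zpow_one]
      exact sup_le (le_sup_left.trans (le_algClosure _))
        (closure_le.2 (subset_algClosure_of_image_subset σ hK hu h))
    refine (shift_mono (-1) this).trans ((shift_algClosure_le _ _).trans ?_)
    rw [shift_shift, neg_add_cancel, shift_zero]
  have h₁' := shift_natCast_le (shift_algClosure_le_of_le h₁)
  have h₂' : shift σ⁻¹ 1 F.algClosure ≤ F.algClosure := by
    have := shift_algClosure_le_of_le h₂
    rwa [shift, zpow_neg_one] at this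
  refine ⟨le_sup_left, ⟨u, hu, rfl⟩, le_win (mem_univ 0), win_le.2 fun i _ => ?_⟩
  refine (shift_mono i (le_algClosure F)).trans ?_
  obtain ⟨n, rfl | rfl⟩ := i.eq_nat_or_neg
  · exact h₁' n
  · have := shift_natCast_le h₂' n
    rwa [shift, inv_zpow'] at this

end Subfield

/-- Theorem 1.7: if `σ(K) = K` and `σ(a) ∈ K(a)^alg`, then there
is a finite tuple `c` with coordinates in `K(a)_σ` such that `a ∈ K(c)^alg`
and `σ(c) ∈ K(c, σ^ℓ(c))` for every `ℓ > 0`. -/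
theorem stmt6 [Field U] [IsAlgClosed U] (σ : U ≃+* U) (K : Subfield U)
    (hK : K.map σ.toRingHom = K) {n : ℕ} (a : Fin n → U)
    (ha : ∀ i, IsAlgebraic (fAdj K (Set.range a)) (σ (a i))) :
    ∃ (p : ℕ) (c : Fin p → U),
      (∀ i, c i ∈ diffAdj σ K (Set.range a)) ∧
      (∀ j, IsAlgebraic (fAdj K (Set.range c)) (a j)) ∧
      (∀ ℓ : ℕ, 0 < ℓ → ∀ i,
        σ (c i) ∈ fAdj K (Set.range c ∪ ⇑(σ ^ ℓ) '' Set.range c)) := by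
  have hsh := Subfield.shift_eq_of_map_eq hK
  have hfAdj : ∀ s, fAdj K s = K ⊔ Subfield.closure s := Subfield.toSubfield_adjoin K
  let F := K ⊔ Subfield.closure (Set.range a)
  let W := Subfield.win σ F Set.univ
  have hF : Subfield.IsModel K W F := by
    refine Subfield.isModel_win_univ hK (Set.finite_range a) ?_
    rintro _ ⟨_, ⟨i, rfl⟩, rfl⟩
    exact Subfield.mem_algClosure.2 (hfAdj (Set.range a) ▸ ha i)
  have hW : ∀ i, Subfield.shift σ i W = W := fun i => Subfield.shift_win (by simp)
  obtain ⟨E, hE, hshift⟩ := hF.exists_forall_shift_one_le hsh hW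
  obtain ⟨N, hN⟩ := hF.exists_le_win_inter_Icc hsh hE Set.univ_nonempty hE.le
  have hE' := hE.isModel_win hsh hW (Set.singleton_nonempty (N : ℤ)) (Set.finite_singleton _)
  rw [Subfield.win_singleton] at hE'
  obtain ⟨u, hu, hEu⟩ := hE'.fg
  obtain ⟨p, c, -, rfl⟩ := hu.fin_param
  refine ⟨p, c, fun i => ?_, fun j => ?_, fun ℓ hℓ i => ?_⟩
  · have hc : c i ∈ Subfield.shift σ N E := hEu ▸ Subfield.closure_le.1 le_sup_right ⟨i, rfl⟩
    have hle : Subfield.shift σ N E ≤ K ⊔ Subfield.closure (⋃ i : ℕ, (σ ^ i) '' Set.range a) := by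
      refine (Subfield.shift_mono _ (hN N le_rfl)).trans
        ((Subfield.shift_win_le (t := Set.Ici 0) ?_).trans (Subfield.win_le.2 fun j hj => ?_))
      · simp only [Set.mem_inter_iff, Set.mem_Icc, Set.mem_Ici]
        omega
      · obtain ⟨k, rfl⟩ := Int.eq_ofNat_of_zero_le hj
        rw [Subfield.shift_sup, hsh, Subfield.shift_closure, zpow_natCast]
        refine sup_le le_sup_left (le_trans ?_ le_sup_right)
        exact Subfield.closure_mono fun x hx => Set.mem_iUnion.2 ⟨k, hx⟩
    rw [diffAdj, hfAdj]
    exact hle hc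
  · rw [hfAdj, ← hEu]
    refine Subfield.mem_algClosure.1 (hE'.alg (hF.le ?_))
    exact Subfield.closure_le.1 le_sup_right ⟨j, rfl⟩
  · have hc : c i ∈ Subfield.shift σ N E := hEu ▸ Subfield.closure_le.1 le_sup_right ⟨i, rfl⟩
    have hle : Subfield.shift σ 1 (Subfield.shift σ N E) ≤
        Subfield.shift σ N E ⊔ Subfield.shift σ ℓ (Subfield.shift σ N E) := by
      rw [Subfield.shift_shift, Subfield.shift_shift, add_comm, add_comm (ℓ : ℤ),
        ← Subfield.shift_shift, ← Subfield.shift_shift, ← Subfield.shift_sup]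
      exact Subfield.shift_mono _ (hshift ℓ hℓ)
    have hmem := hle ⟨c i, hc, rfl⟩
    rw [hEu, Subfield.shift_sup, hsh, Subfield.shift_closure, zpow_natCast, ← sup_sup_distrib_left,
      ← Subfield.closure_union, ← hfAdj, zpow_one] at hmem
    exact hmem
end
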